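/- Let L ≥ 100 and let S be any subset of {1,...,L²} with |S| ≥ L²/2. Then the least common multiple of the elements of S exceeds 2^L. -/

import Mathlib

open Finset Real ArithmeticFunction

/-! ### Sums of the von Mangoldt function over divisors -/

theorem log_gcd_eq_sum_vonMangoldt {n : ℕ} (hn : n ≠ 0) (P : ℕ) :
    Real.log (Nat.gcd n P) = ∑ d ∈ n.divisors with d ∣ P, vonMangoldt d := by
  rw [← vonMangoldt_sum]
  congr 1
  ext d
  simp [Nat.dvd_gcd_iff, hn]

theorem log_sub_log_gcd_eq_sum_vonMangoldt {n : ℕ} (hn : n ≠ 0) (P : ℕ) :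
    Real.log n - Real.log (Nat.gcd n P) = ∑ d ∈ n.divisors with ¬ d ∣ P, vonMangoldt d := by
  rw [log_gcd_eq_sum_vonMangoldt hn, ← vonMangoldt_sum,
    ← Finset.sum_filter_add_sum_filter_not n.divisors (fun d => d ∣ P)]
  ring

theorem card_filter_dvd_Icc (N d : ℕ) : #{n ∈ Icc 1 N | d ∣ n} = N / d :=
  Nat.Ioc_filter_dvd_card_eq_div N d

theorem sum_log_gcd_eq (N : ℕ) {P : ℕ} (hP : P ≠ 0) :
    ∑ n ∈ Icc 1 N, Real.log (Nat.gcd n P) =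
      ∑ d ∈ P.divisors, vonMangoldt d * ((N / d : ℕ) : ℝ) := by
  have h : ∀ n ∈ Icc 1 N, Real.log (Nat.gcd n P) =
      ∑ d ∈ P.divisors, if d ∣ n then vonMangoldt d else 0 := by
    intro n hn
    have hn0 : n ≠ 0 := by simp at hn; omega
    rw [log_gcd_eq_sum_vonMangoldt hn0, ← Finset.sum_filter]
    congr 1
    ext d
    simp [hn0, hP, and_comm]
  rw [Finset.sum_congr rfl h, Finset.sum_comm]
  refine Finset.sum_congr rfl fun d _ => ?_
  rw [← Finset.sum_filter, Finset.sum_const, card_filter_dvd_Icc, nsmul_eq_mul, mul_comm]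

theorem sum_log_sub_log_gcd_eq (y P : ℕ) :
    ∑ n ∈ Icc 1 y, (Real.log n - Real.log (Nat.gcd n P)) =
      ∑ d ∈ Icc 1 y with ¬ d ∣ P, vonMangoldt d * ((y / d : ℕ) : ℝ) := by
  have h : ∀ n ∈ Icc 1 y, Real.log n - Real.log (Nat.gcd n P) =
      ∑ d ∈ Icc 1 y with ¬ d ∣ P, if d ∣ n then vonMangoldt d else 0 := by
    intro n hn
    simp only [Finset.mem_Icc] at hn
    rw [log_sub_log_gcd_eq_sum_vonMangoldt (by omega), ← Finset.sum_filter]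
    congr 1
    ext d
    simp only [Finset.mem_filter, Nat.mem_divisors, Finset.mem_Icc]
    constructor
    · rintro ⟨⟨h1, h2⟩, h3⟩
      exact ⟨⟨⟨Nat.pos_of_dvd_of_pos h1 (by omega), (Nat.le_of_dvd (by omega) h1).trans hn.2⟩, h3⟩,
        h1⟩
    · rintro ⟨⟨_, h3⟩, h1⟩
      exact ⟨⟨h1, by omega⟩, h3⟩
  rw [Finset.sum_congr rfl h, Finset.sum_comm]
  refine Finset.sum_congr rfl fun d _ => ?_
  rw [← Finset.sum_filter, Finset.sum_const, card_filter_dvd_Icc, nsmul_eq_mul, mul_comm]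

/-! ### The upper bound -/

theorem sum_log_sub_log_gcd_le {N y P : ℕ} {S : Finset ℕ} (hS : S ⊆ Icc 1 N) (hy : 1 ≤ y) :
    ∑ n ∈ S, (Real.log n - Real.log (Nat.gcd n P)) ≤
      N * (∑ d ∈ Icc 1 y with ¬ d ∣ P, vonMangoldt d * (1 / d - 1 / y) +
        Real.log (S.lcm id : ℕ) / y) := by
  set M := S.lcm id with hM
  have hS0 : ∀ n ∈ S, n ≠ 0 := fun n hn => by
    have := hS hn; simp at this; omega
  have hM0 : M ≠ 0 := by
    rw [hM, Ne, Finset.lcm_eq_zero_iff]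
    simpa using fun h => hS0 0 h rfl
  have hy0 : (0 : ℝ) < y := by exact_mod_cast hy
  have key : ∑ n ∈ S, (Real.log n - Real.log (Nat.gcd n P)) =
      ∑ d ∈ M.divisors with ¬ d ∣ P, vonMangoldt d * (#{n ∈ S | d ∣ n} : ℝ) := by
    have h : ∀ n ∈ S, Real.log n - Real.log (Nat.gcd n P) =
        ∑ d ∈ M.divisors with ¬ d ∣ P, if d ∣ n then vonMangoldt d else 0 := by
      intro n hn
      have hnM : n ∣ M := Finset.dvd_lcm (f := id) hn
      rw [log_sub_log_gcd_eq_sum_vonMangoldt (hS0 n hn), ← Finset.sum_filter]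
      congr 1
      ext d
      simp only [Finset.mem_filter, Nat.mem_divisors]
      exact ⟨fun ⟨⟨h1, _⟩, h3⟩ => ⟨⟨⟨h1.trans hnM, hM0⟩, h3⟩, h1⟩,
        fun ⟨⟨_, h3⟩, h1⟩ => ⟨⟨h1, hS0 n hn⟩, h3⟩⟩
    rw [Finset.sum_congr rfl h, Finset.sum_comm]
    refine Finset.sum_congr rfl fun d _ => ?_
    rw [← Finset.sum_filter, Finset.sum_const, nsmul_eq_mul, mul_comm]
  have hcount : ∀ d : ℕ, (#{n ∈ S | d ∣ n} : ℝ) ≤ N * (1 / d) := by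
    intro d
    have h1 : #{n ∈ S | d ∣ n} ≤ N / d := by
      rw [← card_filter_dvd_Icc]
      exact Finset.card_le_card (Finset.filter_subset_filter _ hS)
    calc (#{n ∈ S | d ∣ n} : ℝ) ≤ ((N / d : ℕ) : ℝ) := by exact_mod_cast h1
      _ ≤ (N : ℝ) / d := Nat.cast_div_le
      _ = N * (1 / d) := by ring
  have hsplit : ∑ d ∈ M.divisors with ¬ d ∣ P, vonMangoldt d * (1 / d : ℝ) ≤
      ∑ d ∈ Icc 1 y with ¬ d ∣ P, vonMangoldt d * (1 / d - 1 / y) + Real.log M / y := by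
    have h1 : ∑ d ∈ M.divisors with ¬ d ∣ P, vonMangoldt d * (1 / d : ℝ) =
        ∑ d ∈ M.divisors with ¬ d ∣ P, vonMangoldt d * (1 / d - 1 / y : ℝ) +
        (∑ d ∈ M.divisors with ¬ d ∣ P, vonMangoldt d) / y := by
      rw [Finset.sum_div, ← Finset.sum_add_distrib]
      exact Finset.sum_congr rfl fun d _ => by ring
    have h2 : ∑ d ∈ M.divisors with ¬ d ∣ P, vonMangoldt d ≤ Real.log M := by
      rw [← vonMangoldt_sum]
      exact Finset.sum_le_sum_of_subset_of_nonneg (Finset.filter_subset _ _)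
        fun _ _ _ => vonMangoldt_nonneg
    have h3 : ∑ d ∈ M.divisors with ¬ d ∣ P, vonMangoldt d * (1 / d - 1 / y : ℝ) ≤
        ∑ d ∈ Icc 1 y with ¬ d ∣ P, vonMangoldt d * (1 / d - 1 / y : ℝ) := by
      have h4 : ∑ d ∈ M.divisors with ¬ d ∣ P, vonMangoldt d * (1 / d - 1 / y : ℝ) ≤
          ∑ d ∈ (M.divisors.filter (fun d => ¬ d ∣ P)).filter (fun d => d ≤ y),
            vonMangoldt d * (1 / d - 1 / y : ℝ) := by
        rw [← Finset.sum_filter_add_sum_filter_not _ (fun d => d ≤ y)]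
        have : ∑ d ∈ (M.divisors.filter (fun d => ¬ d ∣ P)).filter (fun d => ¬ d ≤ y),
            vonMangoldt d * (1 / d - 1 / y : ℝ) ≤ 0 := by
          refine Finset.sum_nonpos fun d hd => ?_
          simp only [Finset.mem_filter, not_le] at hd
          have : (y : ℝ) ≤ d := by exact_mod_cast hd.2.le
          have := one_div_le_one_div_of_le hy0 this
          exact mul_nonpos_of_nonneg_of_nonpos vonMangoldt_nonneg (by linarith)
        linarith
      refine h4.trans (Finset.sum_le_sum_of_subset_of_nonneg ?_ ?_)
      · intro d hd
        simp only [Finset.mem_filter, Nat.mem_divisors, Finset.mem_Icc] at hd ⊢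
        exact ⟨⟨Nat.pos_of_dvd_of_pos hd.1.1.1 (Nat.pos_of_ne_zero hM0), hd.2⟩, hd.1.2⟩
      · intro d hd _
        simp only [Finset.mem_filter, Finset.mem_Icc] at hd
        have h5 : (0 : ℝ) < d := by exact_mod_cast hd.1.1
        have h6 : (d : ℝ) ≤ y := by exact_mod_cast hd.1.2
        have := one_div_le_one_div_of_le h5 h6
        exact mul_nonneg vonMangoldt_nonneg (by linarith)
    rw [h1]
    gcongr
  calc ∑ n ∈ S, (Real.log n - Real.log (Nat.gcd n P))
      = ∑ d ∈ M.divisors with ¬ d ∣ P, vonMangoldt d * (#{n ∈ S | d ∣ n} : ℝ) := key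
    _ ≤ ∑ d ∈ M.divisors with ¬ d ∣ P, vonMangoldt d * (N * (1 / d : ℝ)) :=
        Finset.sum_le_sum fun d _ => mul_le_mul_of_nonneg_left (hcount d) vonMangoldt_nonneg
    _ = N * ∑ d ∈ M.divisors with ¬ d ∣ P, vonMangoldt d * (1 / d : ℝ) := by
        rw [Finset.mul_sum]; exact Finset.sum_congr rfl fun d _ => by ring
    _ ≤ _ := by gcongr

/-! ### The lower bound -/

theorem mul_log_sub_sum_posLog_le {N : ℕ} {S : Finset ℕ} (hS : S ⊆ Icc 1 N) (P : ℕ) {z : ℝ}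
    (hz : 0 < z) :
    #S * Real.log z - ∑ n ∈ Icc 1 N, posLog (z * Nat.gcd n P / n) ≤
      ∑ n ∈ S, (Real.log n - Real.log (Nat.gcd n P)) := by
  have h1 : ∑ n ∈ S, posLog (z * Nat.gcd n P / n) ≤
      ∑ n ∈ Icc 1 N, posLog (z * Nat.gcd n P / n) :=
    Finset.sum_le_sum_of_subset_of_nonneg hS fun _ _ _ => posLog_nonneg
  have h2 : ∑ n ∈ S, (Real.log z - posLog (z * Nat.gcd n P / n)) ≤
      ∑ n ∈ S, (Real.log n - Real.log (Nat.gcd n P)) := by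
    refine Finset.sum_le_sum fun n hn => ?_
    have hn0 : 0 < n := (Finset.mem_Icc.1 (hS hn)).1
    have hg : 0 < Nat.gcd n P := Nat.gcd_pos_of_pos_left _ hn0
    have h3 : Real.log (z * Nat.gcd n P / n) ≤ posLog (z * Nat.gcd n P / n) := by
      rw [posLog_apply]; exact le_max_right _ _
    rw [Real.log_div (by positivity) (by positivity),
      Real.log_mul (by positivity) (by positivity)] at h3
    linarith
  rw [Finset.sum_sub_distrib, Finset.sum_const, nsmul_eq_mul] at h2
  linarith

theorem log_factorial_eq_sum (k : ℕ) :
    Real.log (k.factorial) = ∑ n ∈ Icc 1 k, Real.log n := by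
  induction k with
  | zero => simp
  | succ k ih =>
    rw [Finset.sum_Icc_succ_top (by omega), ← ih, Nat.factorial_succ, Nat.cast_mul,
      Real.log_mul (by positivity) (by positivity), add_comm]

theorem log_factorial_le {k : ℕ} (hk : 1 ≤ k) :
    Real.log (k.factorial) ≤ k * Real.log k - k + 1 + Real.log k := by
  induction k, hk using Nat.le_induction with
  | base => simp
  | succ k hk ih =>
    have hk0 : (0 : ℝ) < k := by exact_mod_cast hk
    have h := Real.log_le_sub_one_of_pos (x := (k : ℝ) / (k + 1)) (by positivity)
    rw [Real.log_div (by positivity) (by positivity)] at h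
    have h1 := mul_le_mul_of_nonneg_left h (by positivity : (0 : ℝ) ≤ k + 1)
    have h2 : ((k : ℝ) + 1) * (k / (k + 1) - 1) = -1 := by field_simp; ring
    rw [Nat.factorial_succ, Nat.cast_mul, Real.log_mul (by positivity) (by positivity)]
    push_cast
    linarith

theorem sum_log_div_le (k : ℕ) {X : ℝ} (hX : 0 < X) :
    ∑ n ∈ Icc 1 k, Real.log (X / n) ≤ X := by
  rcases Nat.eq_zero_or_pos k with rfl | hk
  · simpa using hX.le
  have hk0 : (0 : ℝ) < k := by exact_mod_cast hk
  have h1 : ∑ n ∈ Icc 1 k, Real.log (X / n) = k * Real.log X - Real.log (k.factorial) := by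
    rw [log_factorial_eq_sum, Finset.sum_congr rfl fun n hn => Real.log_div hX.ne' (by
      have := (Finset.mem_Icc.1 hn).1; positivity)]
    simp
  have h2 := Stirling.le_log_factorial_stirling hk.ne'
  have h3 : 0 ≤ Real.log k := Real.log_natCast_nonneg k
  have h4 : 0 ≤ Real.log (2 * π) := Real.log_nonneg (by nlinarith [Real.pi_gt_three])
  have h5 := Real.log_le_sub_one_of_pos (div_pos hX hk0)
  rw [Real.log_div hX.ne' hk0.ne'] at h5
  have h6 := mul_le_mul_of_nonneg_left h5 hk0.le
  have h7 : (k : ℝ) * (X / k - 1) = X - k := by field_simp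
  rw [h1]
  nlinarith

theorem sum_posLog_div_le (m : ℕ) {X : ℝ} (hX : 0 < X) :
    ∑ n ∈ Icc 1 m, posLog (X / n) ≤ X := by
  induction m with
  | zero => simpa using hX.le
  | succ m ih =>
    rcases le_or_gt ((m + 1 : ℕ) : ℝ) X with h | h
    · refine le_trans (le_of_eq (Finset.sum_congr rfl fun n hn => ?_)) (sum_log_div_le (m + 1) hX)
      rw [Finset.mem_Icc] at hn
      have hn0 : (0 : ℝ) < n := by exact_mod_cast hn.1
      have hn1 : (n : ℝ) ≤ (m + 1 : ℕ) := by exact_mod_cast hn.2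
      refine posLog_eq_log (le_trans ?_ (le_abs_self _))
      rw [le_div_iff₀ hn0]
      linarith
    · rw [Finset.sum_Icc_succ_top (by omega)]
      have : posLog (X / (m + 1 : ℕ)) = 0 := by
        rw [posLog_eq_zero_iff, abs_of_pos (by positivity), div_le_one (by positivity)]
        exact h.le
      linarith

theorem sum_posLog_mul_div_le (N : ℕ) {t : ℝ} (ht : 0 < t) :
    ∑ n ∈ Icc 1 N, posLog (t * N / n) ≤ N * (min t 1 + posLog t) := by
  rcases Nat.eq_zero_or_pos N with rfl | hN
  · simp
  have hN0 : (0 : ℝ) < N := by exact_mod_cast hN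
  rcases le_total t 1 with h | h
  · have h1 : posLog t = 0 := by rw [posLog_eq_zero_iff, abs_of_pos ht]; exact h
    rw [min_eq_left h, h1, add_zero, mul_comm (N : ℝ)]
    exact sum_posLog_div_le N (mul_pos ht hN0)
  · rw [min_eq_right h]
    calc ∑ n ∈ Icc 1 N, posLog (t * N / n) ≤ ∑ n ∈ Icc 1 N, (posLog t + posLog (N / n)) := by
          refine Finset.sum_le_sum fun n _ => ?_
          rw [mul_div_assoc]
          exact posLog_mul
      _ = N * posLog t + ∑ n ∈ Icc 1 N, posLog ((N : ℝ) / n) := by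
          rw [Finset.sum_add_distrib]; simp
      _ ≤ N * posLog t + N := by gcongr; exact sum_posLog_div_le N hN0
      _ = _ := by ring

theorem sum_range_gcd_add (P m : ℕ) (f : ℕ → ℝ) :
    ∑ j ∈ range P, f (Nat.gcd (m + j) P) = ∑ r ∈ Icc 1 P, f (Nat.gcd r P) := by
  induction m with
  | zero =>
    cases P with
    | zero => simp
    | succ P =>
      rw [Finset.sum_range_succ', Finset.sum_Icc_succ_top (by omega),
        Finset.range_eq_Ico, Finset.sum_Ico_add' (fun j => f (Nat.gcd (0 + j) (P + 1))) 0 P 1]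
      simp [Finset.Ico_add_one_right_eq_Icc]
  | succ m ih =>
    rw [← ih]
    have h1 := Finset.sum_range_succ (fun j => f (Nat.gcd (m + j) P)) P
    rw [Finset.sum_range_succ'] at h1
    simp only [Nat.gcd_add_self_left, add_zero] at h1
    rw [← add_right_cancel h1]
    exact Finset.sum_congr rfl fun j _ => by rw [add_right_comm, add_assoc]

/-- Averaging over a period: if `f` is nonnegative and antitone in its first argument, a sum of
`f n (gcd n P)` is bounded by its mean over residues, up to the first period. -/
theorem sum_gcd_le_mean (N P : ℕ) (f : ℕ → ℕ → ℝ) (hf0 : ∀ n r, 0 ≤ f n r)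
    (hf : ∀ r m n, 1 ≤ m → m ≤ n → f n r ≤ f m r) :
    P * ∑ n ∈ Ioc P N, f n (Nat.gcd n P) ≤
      ∑ r ∈ Icc 1 P, ∑ n ∈ Icc 1 N, f n (Nat.gcd r P) := by
  calc P * ∑ n ∈ Ioc P N, f n (Nat.gcd n P)
      = ∑ j ∈ range P, ∑ n ∈ Ioc P N, f n (Nat.gcd n P) := by simp
    _ ≤ ∑ j ∈ range P, ∑ n ∈ Ioc P N, f (n - j) (Nat.gcd n P) := by
        refine Finset.sum_le_sum fun j hj => Finset.sum_le_sum fun n hn => ?_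
        simp only [Finset.mem_range, Finset.mem_Ioc] at hj hn
        exact hf _ _ _ (by omega) (by omega)
    _ ≤ ∑ j ∈ range P, ∑ m ∈ Icc 1 N, f m (Nat.gcd (m + j) P) := by
        refine Finset.sum_le_sum fun j hj => ?_
        rw [Finset.mem_range] at hj
        have h1 : ∑ n ∈ Ioc P N, f (n - j) (Nat.gcd n P) =
            ∑ m ∈ (Ioc P N).image (· - j), f m (Nat.gcd (m + j) P) := by
          rw [Finset.sum_image]
          · refine Finset.sum_congr rfl fun n hn => ?_
            rw [Finset.mem_Ioc] at hn
            rw [Nat.sub_add_cancel (by omega)]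
          · intro a ha b hb hab
            simp only [Finset.coe_Ioc, Set.mem_Ioc] at ha hb
            simp only at hab
            omega
        rw [h1]
        refine Finset.sum_le_sum_of_subset_of_nonneg ?_ fun _ _ _ => hf0 _ _
        intro m hm
        simp only [Finset.mem_image, Finset.mem_Ioc, Finset.mem_Icc] at hm ⊢
        omega
    _ = ∑ r ∈ Icc 1 P, ∑ n ∈ Icc 1 N, f n (Nat.gcd r P) := by
        rw [Finset.sum_comm, Finset.sum_comm (s := Icc 1 P)]
        exact Finset.sum_congr rfl fun m _ => sum_range_gcd_add P m (f m)

theorem sum_posLog_gcd_le (N : ℕ) {P : ℕ} (hP : 0 < P) {c : ℝ} (hc : 0 < c) (hc1 : c ≤ 1) :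
    ∑ n ∈ Icc 1 N, posLog (c * N * Nat.gcd n P / n) ≤
      N * ((∑ r ∈ Icc 1 P, (min (c * Nat.gcd r P) 1 + posLog (c * Nat.gcd r P))) / P) +
        P * Real.log N := by
  have hP0 : (0 : ℝ) < P := by exact_mod_cast hP
  have hmean := sum_gcd_le_mean N P (fun n r => posLog (c * N * r / n))
    (fun _ _ => posLog_nonneg) (fun r m n hm hmn => posLog_le_posLog (by positivity) (by gcongr))
  have hclass : ∑ r ∈ Icc 1 P, ∑ n ∈ Icc 1 N, posLog (c * N * Nat.gcd r P / n) ≤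
      ∑ r ∈ Icc 1 P, (N : ℝ) * (min (c * Nat.gcd r P) 1 + posLog (c * Nat.gcd r P)) := by
    refine Finset.sum_le_sum fun r hr => ?_
    have hg : 0 < Nat.gcd r P := Nat.gcd_pos_of_pos_right _ hP
    refine le_trans (le_of_eq (Finset.sum_congr rfl fun n _ => ?_))
      (sum_posLog_mul_div_le N (t := c * Nat.gcd r P) (by positivity))
    ring_nf
  rw [← Finset.mul_sum] at hclass
  have hlarge : ∑ n ∈ Ioc P N, posLog (c * N * Nat.gcd n P / n) ≤
      N * ((∑ r ∈ Icc 1 P, (min (c * Nat.gcd r P) 1 + posLog (c * Nat.gcd r P))) / P) := by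
    rw [← mul_div_assoc, le_div_iff₀ hP0, mul_comm]
    exact hmean.trans hclass
  have hsmall : ∑ n ∈ Icc 1 P, posLog (c * N * Nat.gcd n P / n) ≤ P * Real.log N := by
    have : ∀ n ∈ Icc 1 P, posLog (c * N * Nat.gcd n P / n) ≤ Real.log N := by
      intro n hn
      have hn0 : 0 < n := (Finset.mem_Icc.1 hn).1
      have hg : (Nat.gcd n P : ℝ) ≤ n := by exact_mod_cast Nat.gcd_le_left P hn0
      rw [← log_of_nat_eq_posLog]
      refine posLog_le_posLog (by positivity) ?_
      rw [div_le_iff₀ (by positivity)]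
      have h1 : c * N ≤ N := by nlinarith [(Nat.cast_nonneg N : (0 : ℝ) ≤ N)]
      exact mul_le_mul h1 hg (by positivity) (by positivity)
    simpa using Finset.sum_le_sum this
  have hsub : ∑ n ∈ Icc 1 N, posLog (c * N * Nat.gcd n P / n) ≤
      ∑ n ∈ Icc 1 P, posLog (c * N * Nat.gcd n P / n) +
        ∑ n ∈ Ioc P N, posLog (c * N * Nat.gcd n P / n) := by
    rw [← Finset.sum_union (Finset.disjoint_left.2 fun n h1 h2 => by
      simp only [Finset.mem_Icc, Finset.mem_Ioc] at h1 h2; omega)]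
    refine Finset.sum_le_sum_of_subset_of_nonneg (fun n hn => ?_) fun _ _ _ => posLog_nonneg
    simp only [Finset.mem_Icc, Finset.mem_union, Finset.mem_Ioc] at hn ⊢
    omega
  linarith

/-! ### Large `L` -/

theorem mul_mean_log_gcd_sub_log_le (y : ℕ) {P : ℕ} (hP : P ≠ 0) :
    y * ((∑ r ∈ Icc 1 P, Real.log (Nat.gcd r P)) / P) - Real.log P ≤
      ∑ n ∈ Icc 1 y, Real.log (Nat.gcd n P) := by
  have hP0 : (P : ℝ) ≠ 0 := by exact_mod_cast hP
  have hE : (∑ r ∈ Icc 1 P, Real.log (Nat.gcd r P)) / P =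
      ∑ d ∈ P.divisors, vonMangoldt d / d := by
    rw [sum_log_gcd_eq P hP, Finset.sum_div]
    refine Finset.sum_congr rfl fun d hd => ?_
    have hdP := Nat.dvd_of_mem_divisors hd
    have hd0 : (d : ℝ) ≠ 0 := by exact_mod_cast ne_zero_of_dvd_ne_zero hP hdP
    rw [Nat.cast_div hdP hd0]
    field_simp
  rw [hE, sum_log_gcd_eq y hP, ← vonMangoldt_sum, Finset.mul_sum, ← Finset.sum_sub_distrib]
  refine Finset.sum_le_sum fun d _ => ?_
  have h : (y : ℝ) / d - 1 ≤ ((y / d : ℕ) : ℝ) := by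
    rw [← Nat.floor_div_eq_div (K := ℝ)]
    exact (Nat.sub_one_lt_floor _).le
  calc (y : ℝ) * (vonMangoldt d / d) - vonMangoldt d = vonMangoldt d * ((y : ℝ) / d - 1) := by ring
    _ ≤ _ := mul_le_mul_of_nonneg_left h vonMangoldt_nonneg

theorem sum_vonMangoldt_mul_sub_le {y P : ℕ} (hy : 1 ≤ y) (hP : P ≠ 0) :
    ∑ d ∈ Icc 1 y with ¬ d ∣ P, vonMangoldt d * (1 / d - 1 / y) ≤
      Real.log y - 1 - (∑ r ∈ Icc 1 P, Real.log (Nat.gcd r P)) / P +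
        (1 + Real.log y + Real.log P) / y := by
  have hy0 : (0 : ℝ) < y := by exact_mod_cast hy
  have h1 : y * ∑ d ∈ Icc 1 y with ¬ d ∣ P, vonMangoldt d * (1 / d - 1 / y : ℝ) ≤
      Real.log y.factorial - ∑ n ∈ Icc 1 y, Real.log (Nat.gcd n P) := by
    rw [log_factorial_eq_sum, ← Finset.sum_sub_distrib, sum_log_sub_log_gcd_eq, Finset.mul_sum]
    refine Finset.sum_le_sum fun d _ => ?_
    have h : (y : ℝ) / d - 1 ≤ ((y / d : ℕ) : ℝ) := by
      rw [← Nat.floor_div_eq_div (K := ℝ)]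
      exact (Nat.sub_one_lt_floor _).le
    calc (y : ℝ) * (vonMangoldt d * (1 / d - 1 / y)) = vonMangoldt d * ((y : ℝ) / d - 1) := by
          field_simp
      _ ≤ _ := mul_le_mul_of_nonneg_left h vonMangoldt_nonneg
  have h2 := log_factorial_le hy
  have h3 := mul_mean_log_gcd_sub_log_le y hP
  have h4 : ((1 : ℝ) + Real.log y + Real.log P) / y * y = 1 + Real.log y + Real.log P := by
    field_simp
  refine le_of_mul_le_mul_left ?_ hy0
  nlinarith

theorem two_pow_le_prod_gcd : 2 ^ 6161 ≤ ∏ r ∈ Icc 1 2520, Nat.gcd r 2520 := by decide +kernel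

theorem prod_max_gcd_le_two_pow : ∏ r ∈ Icc 1 2520, max (Nat.gcd r 2520) 12 ≤ 2 ^ 10079 := by
  decide +kernel

theorem sum_min_gcd_eq : ∑ r ∈ Icc 1 2520, min (Nat.gcd r 2520) 12 = 15072 := by decide +kernel

theorem le_sum_log_gcd : 6161 * Real.log 2 ≤ ∑ r ∈ Icc 1 2520, Real.log (Nat.gcd r 2520) := by
  have h : ((2 ^ 6161 : ℕ) : ℝ) ≤ ((∏ r ∈ Icc 1 2520, Nat.gcd r 2520 : ℕ) : ℝ) :=
    Nat.cast_le.2 two_pow_le_prod_gcd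
  rw [Nat.cast_prod, Nat.cast_pow, Nat.cast_ofNat] at h
  have h1 := Real.log_le_log (by positivity) h
  rw [Real.log_pow, Real.log_prod fun r _ => by
    have := Nat.gcd_pos_of_pos_right r (n := 2520) (by norm_num); positivity] at h1
  exact_mod_cast h1

theorem sum_min_add_posLog_gcd_le :
    ∑ r ∈ Icc 1 2520, (min (1 / 12 * (Nat.gcd r 2520 : ℝ)) 1 +
      posLog (1 / 12 * (Nat.gcd r 2520 : ℝ))) ≤
      1256 + 10079 * Real.log 2 - 2520 * Real.log 12 := by
  have hmin : ∀ r : ℕ, min (1 / 12 * (Nat.gcd r 2520 : ℝ)) 1 =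
      ((min (Nat.gcd r 2520) 12 : ℕ) : ℝ) / 12 := by
    intro r
    rw [Nat.cast_min, ← min_div_div_right (by norm_num : (0 : ℝ) ≤ 12)]
    norm_num
    ring_nf
  have hlog : ∀ r : ℕ, posLog (1 / 12 * (Nat.gcd r 2520 : ℝ)) =
      Real.log ((max (Nat.gcd r 2520) 12 : ℕ) : ℝ) - Real.log 12 := by
    intro r
    have h12 : (0 : ℝ) < ((max (Nat.gcd r 2520) 12 : ℕ) : ℝ) := by
      have : 0 < max (Nat.gcd r 2520) 12 := by simp
      exact_mod_cast this
    rw [posLog_eq_log_max_one (by positivity), ← Real.log_div h12.ne' (by norm_num),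
      Nat.cast_max, ← max_div_div_right (by norm_num : (0 : ℝ) ≤ 12), max_comm]
    norm_num
    ring_nf
  have h : ((∏ r ∈ Icc 1 2520, max (Nat.gcd r 2520) 12 : ℕ) : ℝ) ≤ ((2 ^ 10079 : ℕ) : ℝ) :=
    Nat.cast_le.2 prod_max_gcd_le_two_pow
  have hpos : ∀ r ∈ Icc 1 2520, ((max (Nat.gcd r 2520) 12 : ℕ) : ℝ) ≠ 0 := fun r _ => by
    have : max (Nat.gcd r 2520) 12 ≠ 0 := by simp
    exact_mod_cast this
  rw [Nat.cast_prod, Nat.cast_pow, Nat.cast_ofNat] at h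
  have h1 := Real.log_le_log (lt_of_le_of_ne (Finset.prod_nonneg fun _ _ => Nat.cast_nonneg _)
    (Finset.prod_ne_zero_iff.2 hpos).symm) h
  rw [Real.log_pow, Real.log_prod hpos] at h1
  simp_rw [hmin, hlog]
  rw [Finset.sum_add_distrib, Finset.sum_sub_distrib, ← Finset.sum_div, ← Nat.cast_sum,
    sum_min_gcd_eq]
  simp only [Finset.sum_const, Nat.card_Icc, nsmul_eq_mul]
  push_cast at h1 ⊢
  linarith

theorem log_seven_tenths_le : Real.log (7 / 10) ≤ -(0.514 * Real.log 2) := by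
  have h : ((7 : ℝ) / 10) ^ 140 ≤ ((2 : ℝ) ^ 72)⁻¹ := by norm_num
  have h1 := Real.log_le_log (by positivity) h
  rw [Real.log_pow, Real.log_inv, Real.log_pow] at h1
  push_cast at h1
  linarith [Real.log_two_gt_d9]

theorem le_log_twelve : 3.58 * Real.log 2 ≤ Real.log 12 := by
  have h : (2 : ℝ) ^ 179 ≤ 12 ^ 50 := by norm_num
  have h1 := Real.log_le_log (by positivity) h
  rw [Real.log_pow, Real.log_pow] at h1
  push_cast at h1
  linarith

theorem log_le_add_div_sub_one {x a : ℝ} (hx : 0 < x) (ha : 0 < a) :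
    Real.log x ≤ Real.log a + x / a - 1 := by
  have h := Real.log_le_sub_one_of_pos (div_pos hx ha)
  rw [Real.log_div hx.ne' ha.ne'] at h
  linarith

theorem log_le_twelve_mul_log_two {a : ℝ} (h0 : 0 < a) (ha : a ≤ 4096) :
    Real.log a ≤ 12 * Real.log 2 := by
  have h := Real.log_le_log h0 (ha.trans (by norm_num : (4096 : ℝ) ≤ 2 ^ 12))
  rw [Real.log_pow] at h
  exact_mod_cast h

theorem lcm_large_of_four_thousand_le {L : ℕ} (hL : 4000 ≤ L) {S : Finset ℕ}
    (hS : S ⊆ Icc 1 (L ^ 2)) (hcard : L ^ 2 ≤ 2 * #S) :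
    L * Real.log 2 < Real.log (S.lcm id : ℕ) := by
  by_contra! hM
  set y := 7 * L / 10 with hy
  have hy1 : 2799 ≤ y := by omega
  have hLR : (4000 : ℝ) ≤ L := by exact_mod_cast hL
  have hyR : (2799 : ℝ) ≤ y := by exact_mod_cast hy1
  have hyL : (y : ℝ) ≤ 7 / 10 * L := by
    have : 10 * y ≤ 7 * L := by omega
    have : (10 : ℝ) * y ≤ 7 * L := by exact_mod_cast this
    linarith
  have hLy : (7 : ℝ) * L ≤ 10 * y + 9 := by
    have : 7 * L ≤ 10 * y + 9 := by omega
    exact_mod_cast this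
  have hN : (0 : ℝ) < ((L ^ 2 : ℕ) : ℝ) := by push_cast; positivity
  have hl2 := Real.log_two_gt_d9
  have hl2' := Real.log_two_lt_d9
  have hupper := sum_log_sub_log_gcd_le (P := 2520) hS (by omega : 1 ≤ y)
  have hvM := sum_vonMangoldt_mul_sub_le (by omega : 1 ≤ y) (by norm_num : 2520 ≠ 0)
  have hlower := mul_log_sub_sum_posLog_le hS 2520 (z := 1 / 12 * ((L ^ 2 : ℕ) : ℝ))
    (by positivity)
  have hpos := sum_posLog_gcd_le (L ^ 2) (by norm_num : 0 < 2520) (c := 1 / 12) (by norm_num)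
    (by norm_num)
  have hB := sum_min_add_posLog_gcd_le
  have hE := le_sum_log_gcd
  set E := ∑ r ∈ Icc 1 2520, Real.log (Nat.gcd r 2520)
  set B := ∑ r ∈ Icc 1 2520, (min (1 / 12 * (Nat.gcd r 2520 : ℝ)) 1 +
      posLog (1 / 12 * (Nat.gcd r 2520 : ℝ)))
  have hlogN : Real.log ((L ^ 2 : ℕ) : ℝ) = 2 * Real.log L := by
    push_cast; rw [Real.log_pow]; norm_num
  have hlogz : Real.log (1 / 12 * ((L ^ 2 : ℕ) : ℝ)) = 2 * Real.log L - Real.log 12 := by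
    rw [Real.log_mul (by norm_num) hN.ne', hlogN, one_div, Real.log_inv]; ring
  have hlogz0 : 0 ≤ Real.log (1 / 12 * ((L ^ 2 : ℕ) : ℝ)) := by
    refine Real.log_nonneg ?_
    push_cast
    nlinarith
  have hcardR : ((L ^ 2 : ℕ) : ℝ) / 2 ≤ #S := by
    have : ((L ^ 2 : ℕ) : ℝ) ≤ 2 * #S := by exact_mod_cast hcard
    linarith
  have hcard_mul := mul_le_mul_of_nonneg_right hcardR hlogz0
  have hchain := hlower.trans hupper
  rw [hlogz] at hcard_mul
  rw [hlogz] at hchain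
  rw [hlogN] at hpos
  have hlogL : Real.log L ≤ 12 * Real.log 2 + L / 4000 - 1 :=
    (log_le_add_div_sub_one (a := 4000) (by positivity) (by norm_num)).trans
      (by linarith [log_le_twelve_mul_log_two (a := 4000) (by norm_num) (by norm_num)])
  have hlogy : Real.log y ≤ Real.log L - 0.514 * Real.log 2 := by
    have h := Real.log_le_log (by positivity) hyL
    rw [Real.log_mul (by norm_num) (by positivity)] at h
    linarith [log_seven_tenths_le]
  have hlogy' : Real.log y ≤ 12 * Real.log 2 + y / 2800 - 1 :=
    (log_le_add_div_sub_one (a := 2800) (by positivity) (by norm_num)).trans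
      (by linarith [log_le_twelve_mul_log_two (a := 2800) (by norm_num) (by norm_num)])
  have herr1 : (1 + Real.log y + Real.log (2520 : ℕ)) / y ≤ 0.0066 := by
    have h := log_le_twelve_mul_log_two (a := (2520 : ℕ)) (by norm_num) (by norm_num)
    rw [div_le_iff₀ (by positivity)]
    push_cast at h ⊢
    linarith
  have herr2 : 5040 * Real.log L ≤ ((L ^ 2 : ℕ) : ℝ) * 0.0027 := by
    push_cast
    nlinarith
  have hM' : Real.log (S.lcm id : ℕ) / y ≤ 1.4293 * Real.log 2 := by
    rw [div_le_iff₀ (by positivity)]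
    nlinarith
  have hfac : Real.log L - Real.log 12 / 2 - B / 2520 - 0.0027 ≤
      Real.log y - 1 - E / 2520 + 0.0066 + 1.4293 * Real.log 2 := by
    refine le_of_mul_le_mul_left ?_ hN
    have h1 := mul_le_mul_of_nonneg_left (add_le_add hvM hM') hN.le
    have h2 := mul_le_mul_of_nonneg_left herr1 hN.le
    push_cast at h1 h2 hchain hcard_mul hpos herr2 ⊢
    linarith
  linarith [le_log_twelve]

/-! ### Small `L` -/

/-- A Chebyshev-type sum, equal to `∑ d ≤ y, Λ d * (1 / d - 1 / y)` for `1 ≤ y`. -/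
noncomputable def lcmUptoSum (y : ℕ) : ℝ :=
  ∑ n ∈ range y, Real.log (Nat.lcmUpto n) / (n * (n + 1))

theorem sum_vonMangoldt_mul_sub_eq_lcmUptoSum {y : ℕ} (hy : 1 ≤ y) :
    ∑ d ∈ Icc 1 y, vonMangoldt d * (1 / d - 1 / y) = lcmUptoSum y := by
  induction y, hy using Nat.le_induction with
  | base => simp [lcmUptoSum]
  | succ y hy ih =>
    have hy0 : (y : ℝ) ≠ 0 := by positivity
    have hpsi : Real.log (Nat.lcmUpto y) = ∑ d ∈ Icc 1 y, vonMangoldt d := by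
      rw [← Chebyshev.psi_eq_log_lcmUpto, Chebyshev.psi, Nat.floor_natCast]
      rfl
    rw [lcmUptoSum, Finset.sum_range_succ, ← lcmUptoSum, ← ih, hpsi,
      Finset.sum_Icc_succ_top (by omega), sub_self, mul_zero, add_zero, Finset.sum_div,
      ← Finset.sum_add_distrib]
    refine Finset.sum_congr rfl fun d _ => ?_
    push_cast
    field_simp
    ring

theorem lcm_large_of_lcmUptoSum {L y : ℕ} (hy : 1 ≤ y) (hL : 2 ≤ L)
    (h : lcmUptoSum y + L / y * Real.log 2 + (1 + Real.log 2) / 2 < Real.log L)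
    {S : Finset ℕ} (hS : S ⊆ Icc 1 (L ^ 2)) (hcard : L ^ 2 ≤ 2 * #S) :
    L * Real.log 2 < Real.log (S.lcm id : ℕ) := by
  by_contra! hM
  have hyR : (0 : ℝ) < y := by exact_mod_cast hy
  have hLR : (2 : ℝ) ≤ L := by exact_mod_cast hL
  have hN : (0 : ℝ) < ((L ^ 2 : ℕ) : ℝ) := by push_cast; positivity
  have hupper := sum_log_sub_log_gcd_le (P := 1) hS hy
  have hlower := mul_log_sub_sum_posLog_le hS 1 (z := 1 / 2 * ((L ^ 2 : ℕ) : ℝ)) (by positivity)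
  have hpos := sum_posLog_mul_div_le (L ^ 2) (t := 1 / 2) (by norm_num)
  have hhalf : posLog (1 / 2 : ℝ) = 0 := by
    rw [posLog_eq_zero_iff, abs_of_pos] <;> norm_num
  rw [hhalf, min_eq_left (by norm_num)] at hpos
  have hvM : ∑ d ∈ Icc 1 y with ¬ d ∣ 1, vonMangoldt d * (1 / d - 1 / y : ℝ) ≤ lcmUptoSum y := by
    rw [← sum_vonMangoldt_mul_sub_eq_lcmUptoSum hy]
    refine Finset.sum_le_sum_of_subset_of_nonneg (Finset.filter_subset _ _) fun d hd _ => ?_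
    rw [Finset.mem_Icc] at hd
    have h5 : (0 : ℝ) < d := by exact_mod_cast hd.1
    have h6 : (d : ℝ) ≤ y := by exact_mod_cast hd.2
    have := one_div_le_one_div_of_le h5 h6
    exact mul_nonneg vonMangoldt_nonneg (by linarith)
  have hlogz : Real.log (1 / 2 * ((L ^ 2 : ℕ) : ℝ)) = 2 * Real.log L - Real.log 2 := by
    rw [Real.log_mul (by norm_num) hN.ne', one_div, Real.log_inv]
    push_cast
    rw [Real.log_pow]
    push_cast
    ring
  have hlogz0 : 0 ≤ Real.log (1 / 2 * ((L ^ 2 : ℕ) : ℝ)) := by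
    refine Real.log_nonneg ?_
    push_cast
    nlinarith
  have hcardR : ((L ^ 2 : ℕ) : ℝ) / 2 ≤ #S := by
    have : ((L ^ 2 : ℕ) : ℝ) ≤ 2 * #S := by exact_mod_cast hcard
    linarith
  have hcard_mul := mul_le_mul_of_nonneg_right hcardR hlogz0
  have hM' : Real.log (S.lcm id : ℕ) / y ≤ L / y * Real.log 2 := by
    rw [div_mul_eq_mul_div]
    gcongr
  have hchain := hlower.trans hupper
  simp only [Nat.gcd_one_right, Nat.cast_one, mul_one] at hchain
  rw [hlogz] at hcard_mul
  rw [hlogz] at hchain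
  have h1 := mul_le_mul_of_nonneg_left (add_le_add hvM hM') hN.le
  have h2 := mul_lt_mul_of_pos_left h hN
  linarith

/-- `f n`, arranged so that kernel reduction evaluates `n` before substituting it. -/
def evalFirst (n : ℕ) (f : ℕ → Bool) : Bool :=
  match n with
  | 0 => f 0
  | m + 1 => f (m + 1)

theorem evalFirst_eq (n : ℕ) (f : ℕ → Bool) : evalFirst n f = f n := by
  cases n <;> rfl

/-- An upper bound for `32 * log₂ q`. -/
def logBound (q : ℕ) : ℕ := Nat.log2 (q ^ 32 - 1) + 1

/-- The inequality tested at each `y ≥ 70`: `g` approximates `32 * log₂ y` from above, and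
`a / 2 ^ 30` bounds `lcmUptoSum y / log 2`. -/
def rowCheck (y g a : ℕ) : Bool :=
  bif Nat.ble 70 y then
    Nat.ble (2 ^ g) (2 * y ^ 32) &&
      Nat.ble (a + (2 ^ 30 * (10 * (y + 1)) / (7 * y) + 1) + 759600000 + 2 ^ 25) (2 ^ 25 * g)
  else true

/-- Runs `rowCheck` on `k` consecutive values starting at `y`, where `l = lcmUpto y` and
`e` is an upper bound for `32 * log₂ l`. -/
def tableCheck : ℕ → ℕ → ℕ → ℕ → ℕ → ℕ → Bool
  | 0, _, _, _, _, _ => true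
  | k + 1, y, g, l, e, a =>
    rowCheck y g a &&
    evalFirst (y + 1) fun y' =>
    evalFirst (bif Nat.ble (y' ^ 32) (2 ^ g) then g
      else bif Nat.ble y' 50 then logBound y' else g + 1) fun g' =>
    Nat.ble (y' ^ 32) (2 ^ g') &&
    evalFirst (Nat.lcm l y') fun l' =>
    evalFirst (l' / l) fun q =>
    evalFirst (bif Nat.beq q 1 then e else bif Nat.beq q y' then e + g' else e + logBound q)
      fun e' =>
    evalFirst (a + (2 ^ 25 * e / (y * y') + 1)) fun a' => tableCheck k y' g' l' e' a'

theorem tableCheck_2800 : tableCheck 2800 1 0 1 0 0 = true := by decide +kernel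

theorem log_le_of_pow_le_two_pow {q c : ℕ} (hq : 0 < q) (h : q ^ 32 ≤ 2 ^ c) :
    32 * Real.log q ≤ c * Real.log 2 := by
  have h1 : ((q : ℝ)) ^ 32 ≤ 2 ^ c := by exact_mod_cast h
  have h2 := Real.log_le_log (by positivity) h1
  rw [Real.log_pow, Real.log_pow] at h2
  exact_mod_cast h2

theorem pow_le_two_pow_logBound (q : ℕ) : q ^ 32 ≤ 2 ^ logBound q := by
  have := Nat.lt_log2_self (n := q ^ 32 - 1)
  unfold logBound
  omega

theorem cast_div_le_cast_div_add_one (m n : ℕ) : (m : ℝ) / n ≤ ((m / n + 1 : ℕ) : ℝ) := by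
  rw [← Nat.floor_div_eq_div (K := ℝ)]
  push_cast
  exact (Nat.lt_floor_add_one _).le

theorem lcmUpto_succ (y : ℕ) : Nat.lcmUpto (y + 1) = Nat.lcm (Nat.lcmUpto y) (y + 1) := by
  rw [Nat.lcmUpto, ← Finset.insert_Icc_right_eq_Icc_add_one (by omega), Finset.lcm_insert,
    Nat.lcm_comm]
  rfl

theorem lcmUptoSum_le_of_rowCheck {y g a : ℕ} (h : rowCheck y g a = true) (hy : 70 ≤ y)
    (ha : lcmUptoSum y ≤ a / 2 ^ 30 * Real.log 2) :
    lcmUptoSum y + 10 * (y + 1) / (7 * y) * Real.log 2 + 0.7074 * Real.log 2 ≤ Real.log y := by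
  have h70 : Nat.ble 70 y = true := Nat.ble_eq_true_of_le hy
  rw [rowCheck, h70, cond_true, Bool.and_eq_true, Nat.ble_eq, Nat.ble_eq] at h
  obtain ⟨h1, h2⟩ := h
  have hl2 : 0 < Real.log 2 := Real.log_pos (by norm_num)
  have h3 : (2 : ℝ) ^ g ≤ 2 * (y : ℝ) ^ 32 := by exact_mod_cast h1
  have h4 := Real.log_le_log (by positivity) h3
  have hy0 : (0 : ℝ) < y := by positivity
  rw [Real.log_mul (by norm_num) (by positivity), Real.log_pow, Real.log_pow] at h4
  have h5 := cast_div_le_cast_div_add_one (2 ^ 30 * (10 * (y + 1))) (7 * y)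
  have h6 : (a : ℝ) + ((2 ^ 30 * (10 * (y + 1)) / (7 * y) + 1 : ℕ) : ℝ) + 759600000 + 2 ^ 25 ≤
      2 ^ 25 * g := by exact_mod_cast h2
  have h7 : (a : ℝ) / 2 ^ 30 + 10 * (y + 1) / (7 * y) + 0.7074 ≤ (g - 1) / 32 := by
    have h8 : ((2 ^ 30 * (10 * (y + 1)) : ℕ) : ℝ) / ((7 * y : ℕ) : ℝ) =
        2 ^ 30 * (10 * (y + 1) / (7 * y)) := by push_cast; ring
    rw [h8] at h5
    linarith
  have h9 := mul_le_mul_of_nonneg_right h7 hl2.le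
  push_cast at h4
  linarith

theorem log_lcm_le {m n e g : ℕ} (hm : 0 < m) (hn : 0 < n)
    (he : 32 * Real.log m ≤ e * Real.log 2) (hg : n ^ 32 ≤ 2 ^ g) :
    32 * Real.log (Nat.lcm m n : ℕ) ≤
      ((bif Nat.beq (Nat.lcm m n / m) 1 then e
        else bif Nat.beq (Nat.lcm m n / m) n then e + g
        else e + logBound (Nat.lcm m n / m) : ℕ) : ℝ) * Real.log 2 := by
  have hlcm : 0 < Nat.lcm m n := Nat.lcm_pos hm hn
  obtain ⟨q, hq⟩ := Nat.dvd_lcm_left m n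
  have hq0 : 0 < q := Nat.pos_of_mul_pos_left (hq ▸ hlcm)
  have hlog : Real.log (Nat.lcm m n : ℕ) = Real.log m + Real.log q := by
    rw [hq, Nat.cast_mul, Real.log_mul (by positivity) (by positivity)]
  rw [hlog, hq, Nat.mul_div_cancel_left q hm]
  have h1 := log_le_of_pow_le_two_pow hq0 (pow_le_two_pow_logBound q)
  have h2 := log_le_of_pow_le_two_pow hn hg
  generalize logBound q = b at h1 ⊢
  cases h3 : Nat.beq q 1 with
  | true =>
    rw [Nat.eq_of_beq_eq_true h3]
    simpa using he
  | false =>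
    cases h4 : Nat.beq q n with
    | true =>
      rw [Nat.eq_of_beq_eq_true h4, cond_false, cond_true, Nat.cast_add]
      linarith
    | false =>
      rw [cond_false, cond_false, Nat.cast_add]
      linarith

theorem lcmUptoSum_succ_le {y e a : ℕ} (hy : 1 ≤ y)
    (he : 32 * Real.log (Nat.lcmUpto y) ≤ e * Real.log 2)
    (ha : lcmUptoSum y ≤ a / 2 ^ 30 * Real.log 2) :
    lcmUptoSum (y + 1) ≤
      ((a + (2 ^ 25 * e / (y * (y + 1)) + 1) : ℕ) : ℝ) / 2 ^ 30 * Real.log 2 := by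
  have hy0 : (0 : ℝ) < y := by exact_mod_cast hy
  have hl2 : 0 < Real.log 2 := Real.log_pos (by norm_num)
  rw [lcmUptoSum, Finset.sum_range_succ, ← lcmUptoSum]
  have h1 := cast_div_le_cast_div_add_one (2 ^ 25 * e) (y * (y + 1))
  have h2 : Real.log (Nat.lcmUpto y) / (y * (y + 1)) ≤
      ((2 ^ 25 * e : ℕ) : ℝ) / ((y * (y + 1) : ℕ) : ℝ) / 2 ^ 30 * Real.log 2 := by
    have h3 : ((2 ^ 25 * e : ℕ) : ℝ) / ((y * (y + 1) : ℕ) : ℝ) / 2 ^ 30 * Real.log 2 =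
        (e * Real.log 2 / 32) / (y * (y + 1)) := by
      push_cast
      field_simp
      ring
    rw [h3]
    gcongr
    linarith
  generalize 2 ^ 25 * e / (y * (y + 1)) + 1 = c at h1 ⊢
  have h4 := mul_le_mul_of_nonneg_right
    (div_le_div_of_nonneg_right h1 (by norm_num : (0 : ℝ) ≤ 2 ^ 30)) hl2.le
  rw [Nat.cast_add]
  linarith

theorem lcmUptoSum_le_of_tableCheck (k : ℕ) : ∀ y g l e a : ℕ,
    tableCheck k y g l e a = true → 1 ≤ y → l = Nat.lcmUpto y →
    32 * Real.log l ≤ e * Real.log 2 → lcmUptoSum y ≤ a / 2 ^ 30 * Real.log 2 →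
    ∀ x, 70 ≤ x → y ≤ x → x < y + k →
    lcmUptoSum x + 10 * (x + 1) / (7 * x) * Real.log 2 + 0.7074 * Real.log 2 ≤ Real.log x := by
  induction k with
  | zero => intros; omega
  | succ k ih =>
    intro y g l e a h hy hl he ha x hx70 hyx hxk
    simp only [tableCheck, evalFirst_eq] at h
    rw [Bool.and_eq_true, Bool.and_eq_true] at h
    obtain ⟨hrow, hg, hrec⟩ := h
    rw [Nat.ble_eq] at hg
    rcases hyx.eq_or_lt with rfl | hlt
    · exact lcmUptoSum_le_of_rowCheck hrow hx70 ha
    have he' := log_lcm_le (hl ▸ Nat.lcmUpto_pos y) (Nat.succ_pos y) he hg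
    have ha' := lcmUptoSum_succ_le hy (hl ▸ he) ha
    exact ih _ _ _ _ _ hrec (by omega) (by rw [hl, lcmUpto_succ]) he' ha' x hx70 hlt (by omega)

theorem lcmUptoSum_le {x : ℕ} (h70 : 70 ≤ x) (hx : x ≤ 2800) :
    lcmUptoSum x + 10 * (x + 1) / (7 * x) * Real.log 2 + 0.7074 * Real.log 2 ≤ Real.log x :=
  lcmUptoSum_le_of_tableCheck 2800 1 0 1 0 0 tableCheck_2800 le_rfl (by simp [Nat.lcmUpto])
    (by simp) (by simp [lcmUptoSum]) x h70 (by omega) (by omega)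

theorem lcm_large_of_lt_four_thousand {L : ℕ} (h100 : 100 ≤ L) (hL : L < 4000) {S : Finset ℕ}
    (hS : S ⊆ Icc 1 (L ^ 2)) (hcard : L ^ 2 ≤ 2 * #S) :
    L * Real.log 2 < Real.log (S.lcm id : ℕ) := by
  set y := 7 * L / 10 with hy
  have hy1 : 70 ≤ y := by omega
  refine lcm_large_of_lcmUptoSum (y := y) (by omega) (by omega) ?_ hS hcard
  have hy0 : (0 : ℝ) < y := by positivity
  have hyL : (y : ℝ) ≤ 7 / 10 * L := by
    have : 10 * y ≤ 7 * L := by omega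
    have : (10 : ℝ) * y ≤ 7 * L := by exact_mod_cast this
    linarith
  have hLy : (7 : ℝ) * L ≤ 10 * (y + 1) := by
    have : 7 * L ≤ 10 * (y + 1) := by omega
    exact_mod_cast this
  have hl2 := Real.log_two_gt_d9
  have hlogy := Real.log_le_log hy0 hyL
  rw [Real.log_mul (by norm_num) (by positivity)] at hlogy
  have hquot : (L : ℝ) / y * Real.log 2 ≤ 10 * (y + 1) / (7 * y) * Real.log 2 := by
    refine mul_le_mul_of_nonneg_right ?_ (by linarith)
    rw [div_le_div_iff₀ hy0 (by positivity)]
    nlinarith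
  linarith [lcmUptoSum_le hy1 (by omega), log_seven_tenths_le]

/-- If `L ≥ 100` and `S ⊆ {1,…,L²}` with `|S| ≥ L²/2`, then `lcm S > 2^L`. -/
theorem lcm_large (L : ℕ) (hL : 100 ≤ L) (S : Finset ℕ)
    (hS : S ⊆ Finset.Icc 1 (L ^ 2)) (hcard : L ^ 2 ≤ 2 * S.card) :
    2 ^ L < S.lcm id := by
  have h : L * Real.log 2 < Real.log (S.lcm id : ℕ) := by
    rcases lt_or_ge L 4000 with h | h
    · exact lcm_large_of_lt_four_thousand hL h hS hcard
    · exact lcm_large_of_four_thousand_le h hS hcard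
  by_contra! hle
  have hpos : 0 < S.lcm id := by
    refine Nat.pos_of_ne_zero fun h0 => ?_
    rw [h0, Nat.cast_zero, Real.log_zero] at h
    exact h.not_ge (by positivity)
  have hle' : ((S.lcm id : ℕ) : ℝ) ≤ 2 ^ L := by exact_mod_cast hle
  have h1 := Real.log_le_log (by exact_mod_cast hpos) hle'
  rw [Real.log_pow] at h1
  exact h.not_ge h1
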